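/- There exists a finite simple graph G = (V,E) of maximum degree 5 with a rotation system such that G has low edge density (for every S ⊆ V, the number of edges with both endpoints in S is at most 2|S|) but (G, rotation system) admits no angle cover. -/

import Mathlib

open SimpleGraph

/-- A rotation system on a simple graph `G`: for each vertex `v`, a permutation of
`Sym2 V` that fixes all non-incident edges and acts as a single cycle on the set of
edges incident to `v` (a cyclic ordering of the incident edges). -/
structure RotationSystem {V : Type*} (G : SimpleGraph V) where
  rot : V → Equiv.Perm (Sym2 V)
  fixes : ∀ v e, e ∉ G.incidenceSet v → rot v e = e
  cyclic : ∀ v, ∀ e ∈ G.incidenceSet v, ∀ e' ∈ G.incidenceSet v,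
    ∃ n : ℕ, ((rot v) ^ n) e = e'

/-- Two distinct edges incident to `v` are consecutive at `v` if they are adjacent
in the cyclic ordering given by the rotation system. -/
def RotationSystem.Consecutive {V : Type*} {G : SimpleGraph V} (ρ : RotationSystem G)
    (v : V) (e e' : Sym2 V) : Prop :=
  e ≠ e' ∧ e ∈ G.incidenceSet v ∧ e' ∈ G.incidenceSet v ∧
    (ρ.rot v e = e' ∨ ρ.rot v e' = e)

/-- An angle cover: each vertex `v` gets at most two incident edges, pairwise
consecutive at `v`, and every edge is covered at one of its endpoints. -/
def RotationSystem.IsAngleCover {V : Type*} {G : SimpleGraph V} (ρ : RotationSystem G)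
    (A : V → Finset (Sym2 V)) : Prop :=
  (∀ v, (A v).card ≤ 2) ∧
  (∀ v, ∀ e ∈ A v, e ∈ G.incidenceSet v) ∧
  (∀ v, ∀ e ∈ A v, ∀ e' ∈ A v, e ≠ e' → ρ.Consecutive v e e') ∧
  (∀ e ∈ G.edgeSet, ∃ v, v ∈ e ∧ e ∈ A v)

/-- Neighbours in rotation order. -/
def nb6 : Fin 6 → List (Fin 6) :=
  ![[5, 3], [4, 3, 5, 2], [3, 4, 5, 1], [2, 1, 5, 0, 4], [1, 5, 3, 2], [0, 3, 2, 4, 1]]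

/-- The graph. -/
def G6 : SimpleGraph (Fin 6) where
  Adj a b := b ∈ nb6 a
  symm := ⟨by decide⟩
  loopless := ⟨by decide⟩

instance : DecidableRel G6.Adj := fun a b => inferInstanceAs (Decidable (b ∈ nb6 a))

/-- The rotation at a vertex. -/
def rot6 (v : Fin 6) : Equiv.Perm (Sym2 (Fin 6)) :=
  ((nb6 v).map (fun w => s(v, w))).formPerm

set_option maxRecDepth 100000 in
/-- The rotation system. -/
def rho6 : RotationSystem G6 where
  rot := rot6
  fixes := by
    intro v e he
    apply List.formPerm_apply_of_notMem
    intro h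
    apply he
    simp only [List.mem_map] at h
    obtain ⟨w, hw, rfl⟩ := h
    exact (G6.mk'_mem_incidenceSet_left_iff).2 hw
  cyclic := by
    have key : ∀ v : Fin 6, ∀ a ∈ nb6 v, ∀ b ∈ nb6 v,
        ∃ n : Fin 5, ((rot6 v) ^ (n : ℕ)) s(v, a) = s(v, b) := by decide
    intro v e he e' he'
    obtain ⟨a, rfl⟩ := Sym2.mem_iff_exists.1 he.2
    obtain ⟨b, rfl⟩ := Sym2.mem_iff_exists.1 he'.2
    obtain ⟨n, hn⟩ := key v a he.1 b he'.1
    exact ⟨n, hn⟩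

/-- Orientation witnessing low density: the edges owned by a vertex. -/
def own6 : Fin 6 → Finset (Sym2 (Fin 6)) :=
  ![{s(0, 5), s(0, 3)}, {s(1, 4), s(1, 3)}, {s(1, 2), s(2, 3)}, {s(3, 5), s(3, 4)}, {s(2, 4), s(4, 5)}, {s(1, 5), s(2, 5)}]

/-- There is a finite simple graph of maximum degree 5 with a rotation system that has
low edge density but admits no angle cover. -/
theorem exists_maxDegree_five_low_density_no_angleCover :
    ∃ (V : Type) (_ : Fintype V) (G : SimpleGraph V) (ρ : RotationSystem G),
      (∀ v, (G.neighborSet v).ncard ≤ 5) ∧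
      (∃ v, (G.neighborSet v).ncard = 5) ∧
      (∀ S : Finset V, ({e ∈ G.edgeSet | ∀ v ∈ e, v ∈ S} : Set (Sym2 V)).ncard ≤ 2 * S.card) ∧
      ¬∃ A : V → Finset (Sym2 V), ρ.IsAngleCover A := by
  refine ⟨Fin 6, inferInstance, G6, rho6, ?_, ⟨3, ?_⟩, ?_, ?_⟩
  · intro v
    rw [Set.ncard_eq_toFinset_card']
    revert v
    decide
  · rw [Set.ncard_eq_toFinset_card']
    decide
  · intro S
    have hE : ∀ a b : Fin 6, b ∈ nb6 a → s(a, b) ∈ own6 a ∨ s(a, b) ∈ own6 b := by decide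
    have hsub : ({e ∈ G6.edgeSet | ∀ v ∈ e, v ∈ S} : Set (Sym2 (Fin 6))) ⊆
        ((S.biUnion own6 : Finset (Sym2 (Fin 6))) : Set (Sym2 (Fin 6))) := by
      rintro e ⟨he, hS⟩
      induction e using Sym2.ind with
      | _ a b =>
        have ha := hS a (by simp)
        have hb := hS b (by simp)
        simp only [Finset.coe_biUnion, Set.mem_iUnion, Finset.mem_coe]
        rcases hE a b he with h | h
        · exact ⟨a, ha, h⟩
        · exact ⟨b, hb, h⟩
    refine (Set.ncard_le_ncard hsub (Finset.finite_toSet _)).trans ?_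
    rw [Set.ncard_coe_finset, mul_comm]
    refine Finset.card_biUnion_le_card_mul _ _ _ ?_
    have : ∀ v, (own6 v).card ≤ 2 := by decide
    exact fun v _ => this v
  · rintro ⟨A, -, -, hc, hcov⟩
    have cov : ∀ a b : Fin 6, b ∈ nb6 a → s(a, b) ∈ A a ∨ s(a, b) ∈ A b := by
      intro a b hab
      obtain ⟨v, hv, h⟩ := hcov s(a, b) hab
      rcases Sym2.mem_iff.1 hv with rfl | rfl
      · exact Or.inl h
      · exact Or.inr h
    have non : ∀ v a b : Fin 6, s(v, a) ≠ s(v, b) → ¬ (rot6 v s(v, a) = s(v, b)) →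
        ¬ (rot6 v s(v, b) = s(v, a)) → s(v, a) ∈ A v → s(v, b) ∈ A v → False := by
      intro v a b h1 h2 h3 ha hb
      rcases (hc v _ ha _ hb h1).2.2.2 with h | h
      · exact h2 h
      · exact h3 h
    have c05 := cov 0 5 (by decide)
    have c03 := cov 0 3 (by decide)
    have c14 := cov 1 4 (by decide)
    have c13 := cov 1 3 (by decide)
    have c15 := cov 1 5 (by decide)
    have c12 := cov 1 2 (by decide)
    have c23 := cov 2 3 (by decide)
    have c24 := cov 2 4 (by decide)
    have c25 := cov 2 5 (by decide)
    have c35 := cov 3 5 (by decide)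
    have c34 := cov 3 4 (by decide)
    have c45 := cov 4 5 (by decide)
    have n145 := non 1 4 5 (by decide) (by decide) (by decide)
    have n132 := non 1 3 2 (by decide) (by decide) (by decide)
    have n235 := non 2 3 5 (by decide) (by decide) (by decide)
    have n241 := non 2 4 1 (by decide) (by decide) (by decide)
    have n325 := non 3 2 5 (by decide) (by decide) (by decide)
    have n320 := non 3 2 0 (by decide) (by decide) (by decide)
    have n310 := non 3 1 0 (by decide) (by decide) (by decide)
    have n314 := non 3 1 4 (by decide) (by decide) (by decide)
    have n354 := non 3 5 4 (by decide) (by decide) (by decide)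
    have n413 := non 4 1 3 (by decide) (by decide) (by decide)
    have n452 := non 4 5 2 (by decide) (by decide) (by decide)
    have n502 := non 5 0 2 (by decide) (by decide) (by decide)
    have n504 := non 5 0 4 (by decide) (by decide) (by decide)
    have n534 := non 5 3 4 (by decide) (by decide) (by decide)
    have n531 := non 5 3 1 (by decide) (by decide) (by decide)
    have n521 := non 5 2 1 (by decide) (by decide) (by decide)
    simp only [Sym2.eq_swap (a := (5 : Fin 6)) (b := 0), Sym2.eq_swap (a := (3 : Fin 6)) (b := 0), Sym2.eq_swap (a := (4 : Fin 6)) (b := 1), Sym2.eq_swap (a := (3 : Fin 6)) (b := 1), Sym2.eq_swap (a := (5 : Fin 6)) (b := 1), Sym2.eq_swap (a := (2 : Fin 6)) (b := 1), Sym2.eq_swap (a := (3 : Fin 6)) (b := 2), Sym2.eq_swap (a := (4 : Fin 6)) (b := 2), Sym2.eq_swap (a := (5 : Fin 6)) (b := 2), Sym2.eq_swap (a := (5 : Fin 6)) (b := 3), Sym2.eq_swap (a := (4 : Fin 6)) (b := 3), Sym2.eq_swap (a := (5 : Fin 6)) (b := 4)] at n145 n132 n235 n241 n325 n320 n310 n314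 n354 n413 n452 n502 n504 n534 n531 n521
    clear hc hcov cov non
    grind
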